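/- Let s be a term in which the symbol c does not occur and in which no variable occurring in t₁, …, tₙ occurs. Then for every substitution θ, ι(θ(ρ(s))) = ι(θ)(s); that is, inverting the result of applying θ to the replaced term s equals applying the inverted substitution to s itself. -/

import Mathlib

inductive FOTerm (F : Type) (V : Type) : Type where
  | var : V → FOTerm F V
  | app : F → List (FOTerm F V) → FOTerm F V

namespace FOTerm

variable {F V : Type}

/-- Application of a substitution to a term. -/
def subst (θ : V → FOTerm F V) : FOTerm F V → FOTerm F V
  | .var x => θ x
  | .app f ts => .app f (ts.attach.map fun ⟨t, _⟩ => subst θ t)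

/-- Replacement `ρ`: replace every occurrence of the nullary symbol `u` by `c(tl)`. -/
def replace [DecidableEq F] (u c : F) (tl : List (FOTerm F V)) : FOTerm F V → FOTerm F V
  | .var x => .var x
  | .app f [] => if f = u then .app c tl else .app f []
  | .app f ts => .app f (ts.attach.map fun ⟨t, _⟩ => replace u c tl t)

/-- Inversion `ι`: replace every outermost subterm headed by `c` by the constant `u`. -/
def invert [DecidableEq F] (u c : F) : FOTerm F V → FOTerm F V
  | .var x => .var x
  | .app f ts => if f = c then .app u [] else .app f (ts.attach.map fun ⟨t, _⟩ => invert u c t)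

/-- The variable `x` occurs in a term. -/
inductive OccursVar (x : V) : FOTerm F V → Prop
  | var : OccursVar x (.var x)
  | app {f : F} {ts : List (FOTerm F V)} {t : FOTerm F V} :
      t ∈ ts → OccursVar x t → OccursVar x (.app f ts)

/-- The function symbol `g` occurs (as head of some subterm) in a term. -/
inductive OccursFn (g : F) : FOTerm F V → Prop
  | head {ts : List (FOTerm F V)} : OccursFn g (.app g ts)
  | arg {f : F} {ts : List (FOTerm F V)} {t : FOTerm F V} :
      t ∈ ts → OccursFn g t → OccursFn g (.app f ts)

/-- The domain of a substitution: the variables it moves. -/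
def domain (θ : V → FOTerm F V) : Set V := {x | θ x ≠ FOTerm.var x}

/-- A substitution is a map from variables to terms moving only finitely many variables. -/
def IsSubst (θ : V → FOTerm F V) : Prop := (domain θ).Finite

/-- `ρ` extended to substitutions. -/
def replaceSubst [DecidableEq F] (u c : F) (tl : List (FOTerm F V))
    (θ : V → FOTerm F V) : V → FOTerm F V := fun x => replace u c tl (θ x)

/-- `ι` extended to substitutions. -/
def invertSubst [DecidableEq F] (u c : F) (θ : V → FOTerm F V) : V → FOTerm F V :=
  fun x => invert u c (θ x)

/-- Apply a term transformation to both components of every pair of a unification problem. -/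
def mapProb (g : FOTerm F V → FOTerm F V) (U : Set (FOTerm F V × FOTerm F V)) :
    Set (FOTerm F V × FOTerm F V) := (fun p => (g p.1, g p.2)) '' U

/-- `θ` unifies the unification problem `U`. -/
def Unifies (θ : V → FOTerm F V) (U : Set (FOTerm F V × FOTerm F V)) : Prop :=
  ∀ p ∈ U, subst θ p.1 = subst θ p.2

/-- `U` is unifiable. -/
def Unifiable (U : Set (FOTerm F V × FOTerm F V)) : Prop :=
  ∃ θ, IsSubst θ ∧ Unifies θ U

end FOTerm

namespace FOTerm

variable {F V : Type}

theorem subst_app (θ : V → FOTerm F V) (f : F) (ts : List (FOTerm F V)) :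
    subst θ (.app f ts) = .app f (ts.map (subst θ)) := by
  simp [subst]

theorem replace_app [DecidableEq F] {u c f : F} {tl ts : List (FOTerm F V)}
    (h : ¬ (f = u ∧ ts = [])) :
    replace u c tl (.app f ts) = .app f (ts.map (replace u c tl)) := by
  cases ts <;> simp_all [replace]

theorem invert_app_self [DecidableEq F] (u c : F) (ts : List (FOTerm F V)) :
    invert u c (.app c ts) = .app u [] := by
  simp [invert]

theorem invert_app_of_ne [DecidableEq F] {u c f : F} (h : f ≠ c) (ts : List (FOTerm F V)) :
    invert u c (.app f ts) = .app f (ts.map (invert u c)) := by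
  simp [invert, h]

/-- The condition on the variables of `tl` is not needed for this identity. -/
theorem invert_subst_replace_of_not_occursFn [DecidableEq F] (u c : F)
    (tl : List (FOTerm F V)) (θ : V → FOTerm F V) :
    ∀ s : FOTerm F V, ¬ OccursFn c s →
      invert u c (subst θ (replace u c tl s)) = subst (invertSubst u c θ) s
  | .var x, _ => by simp [replace, subst, invertSubst]
  | .app f ts, hc => by
    by_cases h : f = u ∧ ts = []
    · obtain ⟨rfl, rfl⟩ := h
      simp [replace, subst_app, invert_app_self]
    · have hf : f ≠ c := fun e => hc (e ▸ .head)
      rw [replace_app h, subst_app, invert_app_of_ne hf, subst_app, List.map_map, List.map_map]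
      congr 1
      refine List.map_congr_left fun t ht => ?_
      exact invert_subst_replace_of_not_occursFn u c tl θ t fun ho => hc (.arg ht ho)

end FOTerm

/-- Let `s` be a term in which the symbol `c` does not occur and
in which no variable occurring in `t₁, …, tₙ` (the list `tl`) occurs.  Then for
every substitution `θ`, `ι(θ(ρ(s))) = ι(θ)(s)`. -/
theorem invert_subst_replace {F V : Type} [DecidableEq F]
    (u c : F) (tl : List (FOTerm F V)) (s : FOTerm F V)
    (hc : ¬ FOTerm.OccursFn c s)
    (hvars : ∀ x : V, (∃ t ∈ tl, FOTerm.OccursVar x t) → ¬ FOTerm.OccursVar x s) :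
    ∀ θ : V → FOTerm F V, FOTerm.IsSubst θ →
      FOTerm.invert u c (FOTerm.subst θ (FOTerm.replace u c tl s))
        = FOTerm.subst (FOTerm.invertSubst u c θ) s := by
  exact fun θ _ => FOTerm.invert_subst_replace_of_not_occursFn u c tl θ s hc
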